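/- Let α > 0, p ∈ ℕ, and k ∈ ℕ with k ≤ 2p + 1. Let (a_0, …, a_p) be i.i.d. standard Gaussian random variables and (b_1, …, b_p) be i.i.d. random variables distributed as the square root of a Gamma(α, 1) random variable (i.e., with the χ̃_{2α} distribution, having density (2/Γ(α)) u^{2α−1} e^{−u²} on (0,∞)), with all 2p+1 variables independent. Let T be the (p+1)×(p+1) random symmetric tridiagonal matrix with diagonal entries T_{j,j} = a_j and off-diagonal entries T_{j−1,j} = T_{j,j−1} = b_j. Then the expectation E[(T^k)_{0,0}] equals u_{k/2}(α) if k is even, and equals 0 if k is odd. -/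

import Mathlib

open MeasureTheory ProbabilityTheory

/-- The `N × N` real symmetric tridiagonal matrix with zero diagonal and
off-diagonal entries `M_{k,k+1} = M_{k+1,k} = √(α + k + 1)` for `0 ≤ k ≤ N - 2`. -/
noncomputable def jacobiM (α : ℝ) (N : ℕ) : Matrix (Fin N) (Fin N) ℝ := fun i j =>
  if (i : ℕ) + 1 = (j : ℕ) then Real.sqrt (α + (i : ℕ) + 1)
  else if (j : ℕ) + 1 = (i : ℕ) then Real.sqrt (α + (j : ℕ) + 1)
  else 0

/-- `u n (α) = A_α^{2n}(1,1)`, computed as the `(0,0)` entry of the `2n`-th power of the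
`(n+1) × (n+1)` truncation of the Jacobi matrix `A_α`. -/
noncomputable def u (α : ℝ) (n : ℕ) : ℝ := ((jacobiM α (n + 1)) ^ (2 * n)) 0 0

/-- The `χ̃_{2s}` distribution: the law of the square root of a `Gamma(s, 1)` random
variable, i.e. the pushforward of the `Gamma(s,1)` measure under the square-root map
(with density `(2/Γ(s)) u^{2s-1} e^{-u²}` on `(0,∞)`). -/
noncomputable def tildeChiMeasure (s : ℝ) : Measure ℝ :=
  (gammaMeasure s 1).map Real.sqrt

/-- The `(p+1) × (p+1)` symmetric tridiagonal matrix with diagonal `a_0, …, a_p` and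
off-diagonal entries `T_{j-1,j} = T_{j,j-1} = b_j` for `1 ≤ j ≤ p` (here `b` is indexed by
`Fin p`, with `b i` playing the role of `b_{i+1}`). -/
noncomputable def tridiagOf {p : ℕ} (a : Fin (p + 1) → ℝ) (b : Fin p → ℝ) :
    Matrix (Fin (p + 1)) (Fin (p + 1)) ℝ := fun i j =>
  if i = j then a i
  else if h : (i : ℕ) + 1 = (j : ℕ) then b ⟨i, by have := j.isLt; omega⟩
  else if h2 : (j : ℕ) + 1 = (i : ℕ) then b ⟨j, by have := i.isLt; omega⟩
  else 0

/-- The power series `exp (c x ^ 2)`. -/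
noncomputable def expandedExp {A : Type*} [CommRing A] [Algebra ℚ A] (c : A) : PowerSeries A :=
  PowerSeries.expand 2 two_ne_zero (PowerSeries.rescale c (PowerSeries.exp A))

lemma expandedExp_mul {A : Type*} [CommRing A] [Algebra ℚ A] (c d : A) :
    expandedExp c * expandedExp d = expandedExp (c + d) := by
  simp only [expandedExp, ← map_mul, PowerSeries.exp_mul_exp_eq_exp_add]

lemma coeff_expandedExp {A : Type*} [CommRing A] [Algebra ℚ A] (c : A) (n : ℕ) :
    PowerSeries.coeff n (expandedExp c) =
      if 2 ∣ n then c ^ (n / 2) * algebraMap ℚ A (1 / (n / 2).factorial) else 0 := by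
  simp only [expandedExp, PowerSeries.coeff_expand, PowerSeries.coeff_rescale,
    PowerSeries.coeff_exp]

/-- The coefficients of `exp (x ^ 2 / 2)`. -/
noncomputable def gaussCoeff (n : ℕ) : ℝ := PowerSeries.coeff n (expandedExp (1 / 2 : ℝ))

lemma gaussCoeff_zero : gaussCoeff 0 = 1 := by
  simp [gaussCoeff, coeff_expandedExp]

lemma gaussCoeff_one : gaussCoeff 1 = 0 := by
  simp [gaussCoeff, coeff_expandedExp]

lemma gaussCoeff_add_two (n : ℕ) : (n + 2) * gaussCoeff (n + 2) = gaussCoeff n := by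
  simp only [gaussCoeff, coeff_expandedExp]
  by_cases h : 2 ∣ n
  · obtain ⟨m, rfl⟩ := h
    have h1 : (2 * m + 2) / 2 = m + 1 := by omega
    have h2 : (2 * m) / 2 = m := by omega
    have h3 : 2 ∣ 2 * m + 2 := ⟨m + 1, by ring⟩
    simp only [h1, h2, h3, dvd_mul_right, if_true, Nat.factorial_succ]
    push_cast
    have := Nat.factorial_ne_zero m
    simp
    field_simp
    ring
  · have h3 : ¬ 2 ∣ n + 2 := by omega
    simp [h, h3]

/-- The rising factorial `(s)_n = s (s + 1) ⋯ (s + n - 1)`. -/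
noncomputable def risingFactorial (s : ℝ) (n : ℕ) : ℝ := (ascPochhammer ℝ n).eval s

lemma risingFactorial_zero (s : ℝ) : risingFactorial s 0 = 1 := by simp [risingFactorial]

lemma risingFactorial_succ (s : ℝ) (n : ℕ) :
    risingFactorial s (n + 1) = risingFactorial s n * (s + n) :=
  ascPochhammer_succ_eval n s

lemma risingFactorial_add (s : ℝ) (m n : ℕ) :
    risingFactorial s (m + n) = risingFactorial s m * risingFactorial (s + m) n := by
  simp [risingFactorial, ← ascPochhammer_mul]

lemma risingFactorial_succ_left (s : ℝ) (n : ℕ) :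
    risingFactorial s (n + 1) = s * risingFactorial (s + 1) n := by
  have := risingFactorial_add s 1 n
  rw [add_comm 1 n] at this
  simpa [risingFactorial_succ, risingFactorial_zero] using this

/-- The linear functional `X ^ n ↦ (s)_n (t)_{m - n}`. -/
noncomputable def risingFunctional (s t : ℝ) (m : ℕ) : Polynomial ℝ →ₗ[ℝ] ℝ :=
  Polynomial.lsum fun n => (risingFactorial s n * risingFactorial t (m - n)) • LinearMap.id

lemma risingFunctional_monomial (s t c : ℝ) (m n : ℕ) :
    risingFunctional s t m (Polynomial.C c * Polynomial.X ^ n) =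
      risingFactorial s n * risingFactorial t (m - n) * c := by
  simp [risingFunctional, Polynomial.C_mul_X_pow_eq_monomial, Polynomial.sum_monomial_index]

lemma risingFactorial_add_left (s t : ℝ) (m : ℕ) :
    ∑ n ∈ Finset.range (m + 1), risingFactorial s n * risingFactorial t (m - n) * (m.choose n) =
      risingFactorial (s + t) m := by
  induction m generalizing s t with
  | zero => simp [risingFactorial_zero]
  | succ m ih =>
    have hs := ih (s + 1) t
    have ht := ih s (t + 1)
    rw [risingFactorial_succ_left]
    have e1 : s + 1 + t = s + t + 1 := by ring
    have e2 : s + (t + 1) = s + t + 1 := by ring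
    rw [e1] at hs
    rw [e2] at ht
    rw [add_mul]
    nth_rw 1 [← hs]
    rw [← ht, Finset.mul_sum, Finset.mul_sum, Finset.sum_range_succ']
    rw [Finset.sum_range_succ' (fun i =>
      t * (risingFactorial s i * risingFactorial (t + 1) (m - i) * ↑(m.choose i))), ← add_assoc]
    congr 1
    · rw [Finset.sum_range_succ, Finset.sum_range_succ (fun k => s * _), add_right_comm,
        ← Finset.sum_add_distrib]
      congr 1
      · refine Finset.sum_congr rfl fun n hn => ?_
        rw [Finset.mem_range] at hn
        obtain ⟨d, rfl⟩ := Nat.exists_eq_add_of_lt hn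
        rw [Nat.choose_succ_succ, risingFactorial_succ_left s]
        have a1 : n + d + 1 + 1 - (n + 1) = d + 1 := by omega
        have a2 : n + d + 1 - n = d + 1 := by omega
        have a3 : n + d + 1 - (n + 1) = d := by omega
        rw [a1, a2, a3, risingFactorial_succ_left t]
        push_cast
        ring
      · simp [risingFactorial_succ_left s]
        ring
    · simp [risingFactorial_zero, risingFactorial_succ_left t]

lemma risingFunctional_add_pow (s t : ℝ) (m : ℕ) :
    risingFunctional s t m ((Polynomial.X + 1) ^ m) = risingFactorial (s + t) m := by
  rw [add_pow, map_sum, ← risingFactorial_add_left]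
  refine Finset.sum_congr rfl fun n _ => ?_
  rw [← risingFunctional_monomial]
  congr 1
  simp [mul_comm]

lemma coeff_expandedExp_half_sq (q : Polynomial ℝ) (n : ℕ) :
    PowerSeries.coeff n (expandedExp (Polynomial.C (1 / 2 : ℝ) * q ^ 2)) =
      Polynomial.C (gaussCoeff n) * q ^ n := by
  rw [gaussCoeff, coeff_expandedExp, coeff_expandedExp]
  split_ifs with h
  · obtain ⟨m, rfl⟩ := h
    have h2 : (2 * m) / 2 = m := by omega
    simp only [h2, mul_pow, map_mul, map_pow, ← pow_mul]
    rw [IsScalarTower.algebraMap_apply ℚ ℝ (Polynomial ℝ)]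
    simp only [Polynomial.algebraMap_eq]
    ring
  · simp

open PowerSeries in
/-- A power series agrees with its truncation modulo `X ^ n`. -/
lemma X_pow_dvd_sub_sum {A : Type*} [CommRing A] (f : PowerSeries A) (n : ℕ) :
    (X : PowerSeries A) ^ n ∣ f - ∑ i ∈ Finset.range n, C (coeff i f) * X ^ i := by
  rw [X_pow_dvd_iff]
  intro m hm
  simp only [map_sub, map_sum, coeff_C_mul_X_pow]
  rw [Finset.sum_ite_eq]
  simp [hm]

open PowerSeries in
lemma X_pow_dvd_expandedExp_sub {A : Type*} [CommRing A] [Algebra ℚ A] (c : A) (n : ℕ) :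
    (X : PowerSeries A) ^ n ∣ expandedExp c -
      ∑ l ∈ Finset.range n, C (c ^ l * algebraMap ℚ A (1 / l.factorial)) * X ^ (2 * l) := by
  rw [X_pow_dvd_iff]
  intro m hm
  simp only [map_sub, map_sum, coeff_C_mul_X_pow, coeff_expandedExp]
  split_ifs with h
  · obtain ⟨k, rfl⟩ := h
    rw [Finset.sum_eq_single k]
    · simp
    · intro b _ hb
      rw [if_neg (by omega)]
    · intro h; simp at h; omega
  · rw [Finset.sum_eq_zero, sub_zero]
    intro b _
    rw [if_neg (by omega)]

/-- `∑ (s)_m γ_m x^m`, the expansion of `E[(1 - xZ)^{-s}]` for a standard Gaussian `Z`. -/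
noncomputable def hermiteSeries (s : ℝ) : PowerSeries ℝ :=
  PowerSeries.mk fun m => risingFactorial s m * gaussCoeff m

open PowerSeries in
lemma hermiteSeries_recurrence (s : ℝ) :
    hermiteSeries (s + 1) - C (s + 1) * X ^ 2 * hermiteSeries (s + 2) = hermiteSeries s := by
  ext m
  rw [map_sub, mul_assoc, coeff_C_mul, coeff_X_pow_mul']
  simp only [hermiteSeries, coeff_mk]
  match m with
  | 0 => simp [risingFactorial_zero]
  | 1 => simp [gaussCoeff_one]
  | m + 2 =>
    simp only [le_add_iff_nonneg_left, zero_le, if_true, Nat.add_sub_cancel]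
    rw [← gaussCoeff_add_two m]
    have h1 := risingFactorial_succ_left (s + 1) m
    have h2 := risingFactorial_succ (s + 1) (m + 1)
    have h3 := risingFactorial_succ_left s (m + 1)
    rw [show s + 1 + 1 = s + 2 by ring] at h1
    push_cast at h2
    rw [h2, h3, h1]
    ring

open PowerSeries in
lemma coeff_sum_hermiteSeries (s t : ℝ) (n m : ℕ) (hm : m < n) :
    coeff m (∑ i ∈ Finset.range n, ∑ l ∈ Finset.range n,
      C (risingFactorial t (i + l) * gaussCoeff i * risingFactorial s l / l.factorial) *
        (X ^ (i + 2 * l) * hermiteSeries (s + l))) = coeff m (hermiteSeries (s + t)) := by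
  have key : expandedExp (Polynomial.C (1 / 2 : ℝ) * Polynomial.X ^ 2) *
      expandedExp (Polynomial.X : Polynomial ℝ) *
      expandedExp (Polynomial.C (1 / 2 : ℝ) * 1 ^ 2) =
      expandedExp (Polynomial.C (1 / 2 : ℝ) * (Polynomial.X + 1) ^ 2) := by
    rw [expandedExp_mul, expandedExp_mul]
    congr 1
    have : (Polynomial.X : Polynomial ℝ) = Polynomial.C (1 / 2) * 2 * Polynomial.X := by
      rw [show (2 : Polynomial ℝ) = Polynomial.C 2 from rfl, ← Polynomial.C_mul]
      norm_num
    nth_rw 2 [this]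
    ring
  have hdvd : (X : PowerSeries (Polynomial ℝ)) ^ n ∣
      expandedExp (Polynomial.C (1 / 2 : ℝ) * (Polynomial.X + 1) ^ 2) -
      ∑ i ∈ Finset.range n, ∑ l ∈ Finset.range n,
        C (Polynomial.C (gaussCoeff i * (1 / l.factorial)) * Polynomial.X ^ (i + l)) *
        (X ^ (i + 2 * l) * expandedExp (Polynomial.C (1 / 2 : ℝ) * 1 ^ 2)) := by
    have h1 := X_pow_dvd_sub_sum
      (expandedExp (Polynomial.C (1 / 2 : ℝ) * (Polynomial.X : Polynomial ℝ) ^ 2)) n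
    have h2 := X_pow_dvd_expandedExp_sub (Polynomial.X : Polynomial ℝ) n
    simp only [coeff_expandedExp_half_sq] at h1
    rw [← key]
    obtain ⟨u, hu⟩ := h1
    obtain ⟨v, hv⟩ := h2
    set S₁ := ∑ i ∈ Finset.range n,
      (C (Polynomial.C (gaussCoeff i) * (Polynomial.X : Polynomial ℝ) ^ i) *
        (X : PowerSeries (Polynomial ℝ)) ^ i) with hS₁
    set S₂ := ∑ l ∈ Finset.range n, (C ((Polynomial.X : Polynomial ℝ) ^ l *
      algebraMap ℚ (Polynomial ℝ) (1 / l.factorial)) *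
        (X : PowerSeries (Polynomial ℝ)) ^ (2 * l)) with hS₂
    have hS : ∑ i ∈ Finset.range n, ∑ l ∈ Finset.range n,
        C (Polynomial.C (gaussCoeff i * (1 / l.factorial)) * Polynomial.X ^ (i + l)) *
        (X ^ (i + 2 * l) * expandedExp (Polynomial.C (1 / 2 : ℝ) * 1 ^ 2)) =
        S₁ * S₂ * expandedExp (Polynomial.C (1 / 2 : ℝ) * 1 ^ 2) := by
      rw [hS₁, hS₂, Finset.sum_mul_sum, Finset.sum_mul]
      refine Finset.sum_congr rfl fun i _ => ?_
      rw [Finset.sum_mul]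
      refine Finset.sum_congr rfl fun l _ => ?_
      rw [IsScalarTower.algebraMap_apply ℚ ℝ (Polynomial ℝ)]
      simp only [Polynomial.algebraMap_eq, map_mul, map_pow, pow_add]
      simp
      ring
    rw [hS, eq_add_of_sub_eq hu, eq_add_of_sub_eq hv]
    refine ⟨(u * (X ^ n * v + S₂) + S₁ * v) *
      expandedExp (Polynomial.C (1 / 2 : ℝ) * 1 ^ 2), by ring⟩
  have hc := X_pow_dvd_iff.1 hdvd m hm
  rw [map_sub, coeff_expandedExp_half_sq, sub_eq_zero] at hc
  have hL := congrArg (risingFunctional t s m) hc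
  rw [← Polynomial.smul_eq_C_mul, map_smul, risingFunctional_add_pow, smul_eq_mul] at hL
  rw [hermiteSeries, coeff_mk, mul_comm, add_comm s t, hL]
  simp only [map_sum]
  refine Finset.sum_congr rfl fun i _ => Finset.sum_congr rfl fun l _ => ?_
  rw [coeff_C_mul, coeff_C_mul, coeff_X_pow_mul', coeff_X_pow_mul']
  split_ifs with h
  · obtain ⟨r, rfl⟩ := Nat.exists_eq_add_of_le h
    have e1 : i + 2 * l + r - (i + 2 * l) = r := by omega
    have e2 : i + 2 * l + r - (i + l) = l + r := by omega
    rw [e1, coeff_expandedExp_half_sq, hermiteSeries, coeff_mk, one_pow, mul_one,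
      mul_right_comm (Polynomial.C _),
      ← Polynomial.C_mul, risingFunctional_monomial, e2, risingFactorial_add s l r]
    ring
  · simp
lemma measurePreserving_prod_prod_comm {A B C D : Type*} [MeasurableSpace A] [MeasurableSpace B]
    [MeasurableSpace C] [MeasurableSpace D] (μ : Measure A) (ν : Measure B) (ρ : Measure C)
    (σ : Measure D) [SFinite μ] [SFinite ν] [SFinite ρ] [SFinite σ] :
    MeasurePreserving (fun x : (A × B) × (C × D) => ((x.1.1, x.2.1), (x.1.2, x.2.2)))
      ((μ.prod ν).prod (ρ.prod σ)) ((μ.prod ρ).prod (ν.prod σ)) := by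
  have h1 := measurePreserving_prodAssoc μ ν (ρ.prod σ)
  have h2 := (MeasurePreserving.id μ).prod
    ((measurePreserving_prodAssoc ν ρ σ).symm MeasurableEquiv.prodAssoc)
  have h3 := (MeasurePreserving.id μ).prod
    ((Measure.measurePreserving_swap (μ := ν) (ν := ρ)).prod (MeasurePreserving.id σ))
  have h4 := (MeasurePreserving.id μ).prod (measurePreserving_prodAssoc ρ ν σ)
  have h5 := (measurePreserving_prodAssoc μ ρ (ν.prod σ)).symm MeasurableEquiv.prodAssoc
  exact h5.comp (h4.comp (h3.comp (h2.comp h1)))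

lemma measurePreserving_pi_head_tail (μ ν : Measure ℝ) [SigmaFinite μ] [SigmaFinite ν] (m n : ℕ) :
    MeasurePreserving (fun ω : (Fin (m + 1) → ℝ) × (Fin (n + 1) → ℝ) =>
        ((ω.1 0, ω.2 0), (Fin.tail ω.1, Fin.tail ω.2)))
      ((Measure.pi fun _ => μ).prod (Measure.pi fun _ => ν))
      ((μ.prod ν).prod ((Measure.pi fun _ => μ).prod (Measure.pi fun _ => ν))) := by
  have h1 := measurePreserving_piFinSuccAbove (fun _ : Fin (m + 1) => μ) 0
  have h2 := measurePreserving_piFinSuccAbove (fun _ : Fin (n + 1) => ν) 0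
  exact (measurePreserving_prod_prod_comm _ _ _ _).comp (h1.prod h2)

lemma integrable_and_integral_head_tail (μ ν : Measure ℝ) [SigmaFinite μ] [SigmaFinite ν]
    {m n : ℕ} {f g : ℝ → ℝ} {F : (Fin m → ℝ) × (Fin n → ℝ) → ℝ}
    (hf : Integrable f μ) (hg : Integrable g ν)
    (hF : Integrable F ((Measure.pi fun _ => μ).prod (Measure.pi fun _ => ν))) :
    Integrable (fun ω : (Fin (m + 1) → ℝ) × (Fin (n + 1) → ℝ) =>
        f (ω.1 0) * g (ω.2 0) * F (Fin.tail ω.1, Fin.tail ω.2))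
      ((Measure.pi fun _ => μ).prod (Measure.pi fun _ => ν)) ∧
    ∫ ω : (Fin (m + 1) → ℝ) × (Fin (n + 1) → ℝ),
        f (ω.1 0) * g (ω.2 0) * F (Fin.tail ω.1, Fin.tail ω.2)
        ∂((Measure.pi fun _ => μ).prod (Measure.pi fun _ => ν)) =
      (∫ x, f x ∂μ) * (∫ x, g x ∂ν) *
        ∫ ω, F ω ∂((Measure.pi fun _ => μ).prod (Measure.pi fun _ => ν)) := by
  have hmp := measurePreserving_pi_head_tail μ ν m n
  have hint := (hf.mul_prod hg).mul_prod hF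
  refine ⟨hmp.integrable_comp_of_integrable hint, ?_⟩
  rw [← integral_prod_mul, ← integral_prod_mul, ← hmp.map_eq,
    integral_map hmp.measurable.aemeasurable]
  rw [hmp.map_eq]
  exact hint.aestronglyMeasurable

lemma integrable_pow_gaussianReal (n : ℕ) :
    Integrable (fun x : ℝ => x ^ n) (gaussianReal 0 1) := by
  have := (memLp_id_gaussianReal (μ := 0) (v := 1) n).integrable_norm_pow'
  refine (integrable_norm_iff (by fun_prop)).1 ?_
  simpa using this

lemma integral_pow_add_two_gaussianReal (n : ℕ) :
    ∫ x : ℝ, x ^ (n + 2) ∂(gaussianReal 0 1) = (n + 1) * ∫ x : ℝ, x ^ n ∂(gaussianReal 0 1) := by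
  have hint : ∀ k : ℕ, Integrable (fun x : ℝ => gaussianPDFReal 0 1 x * x ^ k) := by
    intro k
    have := integrable_pow_gaussianReal k
    rw [gaussianReal_of_var_ne_zero _ one_ne_zero,
      integrable_withDensity_iff_integrable_smul' (by fun_prop)
        (Filter.Eventually.of_forall fun x => by simp [gaussianPDF])] at this
    simpa [gaussianPDF, ENNReal.toReal_ofReal, gaussianPDFReal_nonneg] using this
  have hd : ∀ x : ℝ, HasDerivAt (fun x => gaussianPDFReal 0 1 x * x ^ (n + 1))
      ((n + 1) * (gaussianPDFReal 0 1 x * x ^ n) - gaussianPDFReal 0 1 x * x ^ (n + 2)) x := by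
    intro x
    have h1 : HasDerivAt (gaussianPDFReal 0 1) (gaussianPDFReal 0 1 x * (-x)) x := by
      simp only [gaussianPDFReal_def]
      have : HasDerivAt (fun x : ℝ => -(x - 0) ^ 2 / (2 * ((1 : NNReal) : ℝ))) (-x) x := by
        have := (((hasDerivAt_id x).sub_const 0).pow 2).neg.div_const (2 * ((1 : NNReal) : ℝ))
        convert! this using 1
        simp only [id, sub_zero, NNReal.coe_one]
        norm_num
        ring
      convert! (this.exp.const_mul (√(2 * Real.pi * ((1 : NNReal) : ℝ)))⁻¹) using 1
      ring
    convert! h1.mul (hasDerivAt_pow (n + 1) x) using 1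
    push_cast
    simp
    ring
  have h0 := integral_eq_zero_of_hasDerivAt_of_integrable hd
    (((hint n).const_mul _).sub (hint (n + 2))) (hint (n + 1))
  rw [integral_sub ((hint n).const_mul _) (hint (n + 2)), integral_const_mul] at h0
  simp only [integral_gaussianReal_eq_integral_smul one_ne_zero, smul_eq_mul]
  linarith

lemma toReal_gammaPDF_mul_pow {s : ℝ} (hs : 0 < s) (n : ℕ) (x : ℝ) :
    (gammaPDF s 1 x).toReal * x ^ n = (Set.Ici (0:ℝ)).indicator
      (fun x => 1 / Real.Gamma s * (x ^ (s - 1) * Real.exp (-x) * x ^ n)) x := by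
  rw [gammaPDF, ENNReal.toReal_ofReal (gammaPDFReal_nonneg hs one_pos x), gammaPDFReal]
  by_cases hx : 0 ≤ x
  · simp [hx]
    ring
  · simp [hx]

lemma integrable_and_integral_pow_gammaMeasure {s : ℝ} (hs : 0 < s) (n : ℕ) :
    Integrable (fun x : ℝ => x ^ n) (gammaMeasure s 1) ∧
      ∫ x : ℝ, x ^ n ∂(gammaMeasure s 1) = Real.Gamma (s + n) / Real.Gamma s := by
  have hm : Measurable (gammaPDF s 1) := (measurable_gammaPDFReal s 1).ennreal_ofReal
  have hlt : ∀ᵐ x : ℝ, gammaPDF s 1 x < ⊤ :=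
    Filter.Eventually.of_forall fun x => ENNReal.ofReal_lt_top
  have hEq : Set.EqOn (fun x : ℝ => Real.exp (-x) * x ^ (s + n - 1))
      (fun x => x ^ (s - 1) * Real.exp (-x) * x ^ n) (Set.Ioi 0) := by
    intro x hx
    have : x ^ (s + n - 1) = x ^ (s - 1) * x ^ n := by
      rw [← Real.rpow_natCast, ← Real.rpow_add hx]
      congr 1
      ring
    simp only [this]
    ring
  have hsn : 0 < s + n := by positivity
  have hG := (integrableOn_congr_fun hEq measurableSet_Ioi).1 (Real.GammaIntegral_convergent hsn)
  constructor
  · rw [gammaMeasure, integrable_withDensity_iff_integrable_smul' hm hlt]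
    simp only [smul_eq_mul, toReal_gammaPDF_mul_pow hs]
    rw [integrable_indicator_iff measurableSet_Ici, integrableOn_Ici_iff_integrableOn_Ioi]
    exact hG.const_mul _
  · rw [gammaMeasure, integral_withDensity_eq_integral_toReal_smul hm hlt]
    simp only [smul_eq_mul, toReal_gammaPDF_mul_pow hs]
    rw [integral_indicator measurableSet_Ici, integral_Ici_eq_integral_Ioi, integral_const_mul,
      ← setIntegral_congr_fun measurableSet_Ioi hEq, ← Real.Gamma_eq_integral hsn]
    ring

lemma ae_nonneg_gammaMeasure (s : ℝ) : ∀ᵐ x ∂(gammaMeasure s 1), 0 ≤ x := by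
  have hm : Measurable (gammaPDF s 1) := (measurable_gammaPDFReal s 1).ennreal_ofReal
  rw [gammaMeasure, ae_withDensity_iff hm]
  refine Filter.Eventually.of_forall fun x hx => ?_
  by_contra h
  exact hx (gammaPDF_of_neg (not_le.1 h))

lemma integrable_and_integral_even_pow_tildeChiMeasure {s : ℝ} (hs : 0 < s) (n : ℕ) :
    Integrable (fun x : ℝ => x ^ (2 * n)) (tildeChiMeasure s) ∧
      ∫ x : ℝ, x ^ (2 * n) ∂(tildeChiMeasure s) = Real.Gamma (s + n) / Real.Gamma s := by
  have h := integrable_and_integral_pow_gammaMeasure hs n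
  have hsqrt : AEMeasurable Real.sqrt (gammaMeasure s 1) := by fun_prop
  have hae : (fun x : ℝ => √x ^ (2 * n)) =ᵐ[gammaMeasure s 1] fun x => x ^ n := by
    filter_upwards [ae_nonneg_gammaMeasure s] with x hx
    rw [pow_mul, Real.sq_sqrt hx]
  constructor
  · rw [tildeChiMeasure, integrable_map_measure (by fun_prop) hsqrt]
    exact (integrable_congr hae).2 h.1
  · rw [tildeChiMeasure, integral_map hsqrt (by fun_prop), integral_congr_ae hae, h.2]

lemma isProbabilityMeasure_tildeChiMeasure {s : ℝ} (hs : 0 < s) :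
    IsProbabilityMeasure (tildeChiMeasure s) := by
  have := isProbabilityMeasure_gammaMeasure hs one_pos
  exact Measure.isProbabilityMeasure_map (by fun_prop)

lemma integral_pow_gaussianReal (n : ℕ) :
    ∫ x : ℝ, x ^ n ∂(gaussianReal 0 1) = n.factorial * gaussCoeff n := by
  induction n using Nat.twoStepInduction with
  | zero => simp [gaussCoeff_zero]
  | one => simp [gaussCoeff_one]
  | more n ih _ =>
    rw [integral_pow_add_two_gaussianReal, ih, ← gaussCoeff_add_two n, Nat.factorial_succ,
      Nat.factorial_succ]
    push_cast
    ring

lemma Gamma_add_natCast_div {s : ℝ} (hs : 0 < s) (n : ℕ) :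
    Real.Gamma (s + n) / Real.Gamma s = risingFactorial s n := by
  induction n with
  | zero => simp [risingFactorial_zero, (Real.Gamma_pos_of_pos hs).ne']
  | succ n ih =>
    have h : s + n ≠ 0 := by positivity
    rw [risingFactorial_succ, ← ih, Nat.cast_succ, ← add_assoc, Real.Gamma_add_one h]
    ring

section Resolvent

open PowerSeries

/-- The column `(∑ (T ^ k)_{i,0} x ^ k)_i` of the resolvent `(1 - x T)⁻¹`. -/
noncomputable def resolventColumn {p : ℕ} (T : Matrix (Fin (p + 1)) (Fin (p + 1)) ℝ)
    (i : Fin (p + 1)) : PowerSeries ℝ :=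
  mk fun k => (T ^ k) i 0

lemma resolventColumn_eq {p : ℕ} (T : Matrix (Fin (p + 1)) (Fin (p + 1)) ℝ) (i : Fin (p + 1)) :
    resolventColumn T i = (if i = 0 then 1 else 0) + X * ∑ j, C (T i j) * resolventColumn T j := by
  ext k
  cases k with
  | zero =>
    simp only [resolventColumn, coeff_mk, pow_zero, map_add, Matrix.one_apply, coeff_zero_X_mul,
      add_zero]
    split_ifs <;> simp
  | succ k =>
    simp only [resolventColumn, coeff_mk, pow_succ', Matrix.mul_apply, map_add, coeff_succ_X_mul,
      map_sum, coeff_C_mul]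
    split_ifs <;> simp

lemma eq_zero_of_eq_X_mul_sum {p : ℕ} (T : Matrix (Fin p) (Fin p) ℝ)
    (D : Fin p → PowerSeries ℝ) (hD : ∀ i, D i = X * ∑ j, C (T i j) * D j) (i : Fin p) :
    D i = 0 := by
  have h : ∀ n i, (X : PowerSeries ℝ) ^ n ∣ D i := by
    intro n
    induction n with
    | zero => simp
    | succ n ih =>
      intro i
      rw [hD i, pow_succ']
      exact mul_dvd_mul_left _ (Finset.dvd_sum fun j _ => (ih j).mul_left _)
  ext n
  exact X_pow_dvd_iff.1 (h (n + 1) i) n n.lt_succ_self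

lemma tridiagOf_zero_succ {p : ℕ} (a : Fin (p + 2) → ℝ) (b : Fin (p + 1) → ℝ) (j : Fin (p + 1)) :
    tridiagOf a b 0 j.succ = if j = 0 then b 0 else 0 := by
  have h : (0 : Fin (p + 2)) ≠ j.succ := (Fin.succ_ne_zero j).symm
  simp only [tridiagOf, h, if_false, Fin.val_zero, Fin.val_succ, Fin.ext_iff]
  by_cases hj : (j : ℕ) = 0 <;> simp [hj, eq_comm]

lemma tridiagOf_succ_zero {p : ℕ} (a : Fin (p + 2) → ℝ) (b : Fin (p + 1) → ℝ) (i : Fin (p + 1)) :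
    tridiagOf a b i.succ 0 = if i = 0 then b 0 else 0 := by
  simp only [tridiagOf, Fin.val_zero, Fin.val_succ, Fin.ext_iff]
  by_cases hi : (i : ℕ) = 0 <;> simp [hi, eq_comm]

lemma tridiagOf_succ_succ {p : ℕ} (a : Fin (p + 2) → ℝ) (b : Fin (p + 1) → ℝ)
    (i j : Fin (p + 1)) :
    tridiagOf a b i.succ j.succ = tridiagOf (Fin.tail a) (Fin.tail b) i j := by
  simp only [tridiagOf, Fin.succ_inj, Fin.val_succ, Nat.add_right_cancel_iff, Fin.tail]
  rfl

/-- The generating function of the corner moments `(T ^ k)_{0,0}` of a tridiagonal matrix. -/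
noncomputable def cornerSeries {p : ℕ} (a : Fin (p + 1) → ℝ) (b : Fin p → ℝ) : PowerSeries ℝ :=
  mk fun k => (tridiagOf a b ^ k) 0 0

lemma cornerSeries_zero (a : Fin 1 → ℝ) (b : Fin 0 → ℝ) :
    cornerSeries a b * (1 - C (a 0) * X) = 1 := by
  have h := resolventColumn_eq (tridiagOf a b) 0
  simp only [Fin.sum_univ_succ, Finset.univ_eq_empty, Finset.sum_empty, add_zero, if_true] at h
  change cornerSeries a b = 1 + X * (C (a 0) * cornerSeries a b) at h
  linear_combination h

lemma cornerSeries_succ {p : ℕ} (a : Fin (p + 2) → ℝ) (b : Fin (p + 1) → ℝ) :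
    cornerSeries a b * (1 - (C (a 0) * X +
      C (b 0 ^ 2) * X ^ 2 * cornerSeries (Fin.tail a) (Fin.tail b))) = 1 := by
  set V := resolventColumn (tridiagOf a b) with hV
  set W := resolventColumn (tridiagOf (Fin.tail a) (Fin.tail b)) with hW
  have hVs : ∀ i : Fin (p + 1), V i.succ = X * (C (if i = 0 then b 0 else 0) * V 0 +
      ∑ j, C (tridiagOf (Fin.tail a) (Fin.tail b) i j) * V j.succ) := by
    intro i
    rw [hV, resolventColumn_eq, Fin.sum_univ_succ]
    simp only [Fin.succ_ne_zero, if_false, zero_add, tridiagOf_succ_zero, tridiagOf_succ_succ]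
  have hsol : ∀ i, V (Fin.succ i) - X * C (b 0) * V 0 * W i = 0 := by
    refine eq_zero_of_eq_X_mul_sum (tridiagOf (Fin.tail a) (Fin.tail b)) _ fun i => ?_
    have hWi := resolventColumn_eq (tridiagOf (Fin.tail a) (Fin.tail b)) i
    rw [← hW] at hWi
    simp only [mul_sub, Finset.sum_sub_distrib]
    have hsum : ∑ j, C (tridiagOf (Fin.tail a) (Fin.tail b) i j) * (X * C (b 0) * V 0 * W j) =
        X * C (b 0) * V 0 * ∑ j, C (tridiagOf (Fin.tail a) (Fin.tail b) i j) * W j := by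
      rw [Finset.mul_sum]
      exact Finset.sum_congr rfl fun j _ => by ring
    have hif : C (if i = 0 then b 0 else 0) =
        C (b 0) * (if i = 0 then (1 : PowerSeries ℝ) else 0) := by
      split_ifs <;> simp
    rw [hsum, hVs i, hif]
    linear_combination (-(X * C (b 0) * V 0)) * hWi
  have h0 : V 0 = 1 + X * (C (a 0) * V 0 + C (b 0) * V 1) := by
    conv_lhs => rw [hV, resolventColumn_eq, Fin.sum_univ_succ]
    simp only [tridiagOf_zero_succ, if_true]
    rw [Finset.sum_eq_single (0 : Fin (p + 1))]
    · simp [tridiagOf, hV]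
    · intro j _ hj
      simp [hj]
    · simp
  have h1 : V 1 - X * C (b 0) * V 0 * W 0 = 0 := hsol 0
  change V 0 * (1 - (C (a 0) * X + C (b 0 ^ 2) * X ^ 2 * W 0)) = 1
  rw [map_pow]
  linear_combination h0 + X * C (b 0) * h1

lemma one_sub_mul_sum_risingFactorial (k : ℝ) (y : PowerSeries ℝ) (n : ℕ) :
    (1 - y) * ∑ N ∈ Finset.range (n + 1), C (risingFactorial (k + 1) N / N.factorial) * y ^ N =
      ∑ N ∈ Finset.range (n + 1), C (risingFactorial k N / N.factorial) * y ^ N -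
        C (risingFactorial (k + 1) n / n.factorial) * y ^ (n + 1) := by
  induction n with
  | zero => simp [risingFactorial_zero]
  | succ n ih =>
    rw [Finset.sum_range_succ, mul_add, ih, Finset.sum_range_succ _ (n + 1)]
    have hc : risingFactorial (k + 1) (n + 1) / (n + 1).factorial =
        risingFactorial k (n + 1) / (n + 1).factorial +
          risingFactorial (k + 1) n / n.factorial := by
      have h1 : (n.factorial : ℝ) ≠ 0 := by positivity
      rw [risingFactorial_succ, risingFactorial_succ_left, Nat.factorial_succ]
      push_cast
      field_simp
      ring
    rw [hc, map_add]
    ring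

lemma X_pow_dvd_pow_sub_sum (G y : PowerSeries ℝ) (hG : G * (1 - y) = 1)
    (hy : X ∣ y) (k n : ℕ) :
    X ^ n ∣ G ^ k - ∑ N ∈ Finset.range n, C (risingFactorial k N / N.factorial) * y ^ N := by
  cases n with
  | zero => simp
  | succ n =>
    induction k with
    | zero =>
      rw [Finset.sum_range_succ']
      simp [risingFactorial_zero, risingFactorial_succ_left]
    | succ k ih =>
      have h := one_sub_mul_sum_risingFactorial k y n
      have e : G ^ (k + 1) - ∑ N ∈ Finset.range (n + 1),
          C (risingFactorial ((k + 1 : ℕ) : ℝ) N / N.factorial) * y ^ N =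
          G * (G ^ k - ∑ N ∈ Finset.range (n + 1),
            C (risingFactorial k N / N.factorial) * y ^ N) +
          G * C (risingFactorial (k + 1) n / n.factorial) * y ^ (n + 1) := by
        push_cast
        linear_combination (∑ N ∈ Finset.range (n + 1),
          C (risingFactorial ((k : ℝ) + 1) N / N.factorial) * y ^ N) * hG - G * h
      rw [e]
      exact dvd_add (ih.mul_left _) ((pow_dvd_pow_of_dvd hy _).mul_left _)

/-- Coefficient expansion of the powers of the inverse of a first step continued fraction. -/
lemma coeff_pow_eq_sum (G G' : PowerSeries ℝ) (a c : ℝ)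
    (hG : G * (1 - (C a * X + C c * X ^ 2 * G')) = 1) (k n m : ℕ) (hm : m < n) :
    coeff m (G ^ k) = ∑ i ∈ Finset.range n, ∑ l ∈ Finset.range n,
      risingFactorial k (i + l) / (i.factorial * l.factorial) *
        (a ^ i * c ^ l * coeff m (X ^ (i + 2 * l) * G' ^ l)) := by
  set f : ℕ → ℕ → PowerSeries ℝ := fun i l =>
    C (risingFactorial k (i + l) / (i.factorial * l.factorial) * (a ^ i * c ^ l)) *
      (X ^ (i + 2 * l) * G' ^ l) with hf
  have hdvd := X_pow_dvd_pow_sub_sum G (C a * X + C c * X ^ 2 * G') hG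
    ⟨C a + C c * X * G', by ring⟩ k n
  have hsum : ∑ N ∈ Finset.range n, C (risingFactorial k N / N.factorial) *
      (C a * X + C c * X ^ 2 * G') ^ N =
      ∑ i ∈ Finset.range n, ∑ l ∈ Finset.range (n - i), f i l := by
    rw [← Finset.sum_range_diag_flip]
    refine Finset.sum_congr rfl fun N _ => ?_
    rw [add_pow, Finset.mul_sum]
    refine Finset.sum_congr rfl fun i hi => ?_
    rw [Finset.mem_range] at hi
    obtain ⟨l, rfl⟩ := Nat.exists_eq_add_of_le (Nat.lt_succ_iff.1 hi)
    have hch : ((i + l).choose i : ℝ) = (i + l).factorial / (i.factorial * l.factorial) := by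
      rw [Nat.cast_add_choose]
    have hch' : (((i + l).choose i : ℕ) : PowerSeries ℝ) =
        C ((i + l).factorial / (i.factorial * l.factorial) : ℝ) := by
      rw [← hch, map_natCast]
    simp only [hf, Nat.add_sub_cancel_left]
    have h1 : ((i + l).factorial : ℝ) ≠ 0 := by positivity
    have hcoef : risingFactorial k (i + l) / (i.factorial * l.factorial) =
        risingFactorial k (i + l) / (i + l).factorial *
          ((i + l).factorial / (i.factorial * l.factorial)) := by
      field_simp
    rw [hch', hcoef]
    simp only [map_mul, map_pow]
    ring
  have hsq : (X : PowerSeries ℝ) ^ n ∣ ∑ i ∈ Finset.range n, ∑ l ∈ Finset.range n, f i l -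
      ∑ i ∈ Finset.range n, ∑ l ∈ Finset.range (n - i), f i l := by
    rw [← Finset.sum_sub_distrib]
    refine Finset.dvd_sum fun i _ => ?_
    rw [← Finset.sum_range_add_sum_Ico _ (Nat.sub_le n i), add_sub_cancel_left]
    refine Finset.dvd_sum fun l hl => ?_
    rw [Finset.mem_Ico] at hl
    exact ((pow_dvd_pow X (by omega)).mul_right _).mul_left _
  rw [hsum] at hdvd
  have h := X_pow_dvd_iff.1 (dvd_sub hdvd hsq) m hm
  simp only [map_sub, map_sum] at h
  have h' : coeff m (G ^ k) = ∑ i ∈ Finset.range n, ∑ l ∈ Finset.range n, coeff m (f i l) := by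
    linarith
  rw [h']
  refine Finset.sum_congr rfl fun i _ => Finset.sum_congr rfl fun l _ => ?_
  rw [hf, coeff_C_mul]
  ring

end Resolvent
section JacobiMatrix

open PowerSeries

/-- The generating function of the moments of the truncated Jacobi matrix. -/
noncomputable def jacobiSeries (α : ℝ) (p : ℕ) : PowerSeries ℝ :=
  cornerSeries (fun _ : Fin (p + 1) => 0) (fun i : Fin p => √(α + (i : ℕ) + 1))

lemma coeff_jacobiSeries (α : ℝ) (p k : ℕ) :
    coeff k (jacobiSeries α p) = (jacobiM α (p + 1) ^ k) 0 0 := by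
  have h : tridiagOf (fun _ : Fin (p + 1) => 0) (fun i : Fin p => √(α + (i : ℕ) + 1)) =
      jacobiM α (p + 1) := by
    ext i j
    simp only [tridiagOf, jacobiM, Fin.ext_iff]
    split_ifs <;> first | rfl | omega
  rw [jacobiSeries, cornerSeries, coeff_mk, h]

lemma jacobiSeries_zero (α : ℝ) : jacobiSeries α 0 = 1 := by
  simpa [jacobiSeries] using
    cornerSeries_zero (fun _ => 0) (fun i : Fin 0 => √(α + (i : ℕ) + 1))

lemma jacobiSeries_succ {α : ℝ} (hα : 0 < α) (p : ℕ) :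
    jacobiSeries α (p + 1) * (1 - C (α + 1) * X ^ 2 * jacobiSeries (α + 1) p) = 1 := by
  have h := cornerSeries_succ (fun _ : Fin (p + 2) => 0)
    (fun i : Fin (p + 1) => √(α + (i : ℕ) + 1))
  have ht : Fin.tail (fun i : Fin (p + 1) => √(α + (i : ℕ) + 1)) =
      fun i : Fin p => √(α + 1 + (i : ℕ) + 1) := by
    ext i
    simp only [Fin.tail, Fin.val_succ]
    push_cast
    congr 1
    ring
  have hs : √(α + ((0 : Fin (p + 1)) : ℕ) + 1) ^ 2 = α + 1 := by
    rw [Real.sq_sqrt (by positivity)]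
    simp
  rw [ht, hs, map_zero, zero_mul, zero_add] at h
  exact h

lemma X_pow_dvd_jacobiSeries_mul (p : ℕ) {α : ℝ} (hα : 0 < α) :
    X ^ (2 * p + 2) ∣ jacobiSeries α p * hermiteSeries α - hermiteSeries (α + 1) := by
  induction p generalizing α with
  | zero =>
    rw [jacobiSeries_zero, X_pow_dvd_iff]
    intro m hm
    interval_cases m <;>
      simp [hermiteSeries, risingFactorial_zero, gaussCoeff_one]
  | succ p ih =>
    obtain ⟨v, hv⟩ := ih (add_pos hα one_pos)
    have h := jacobiSeries_succ hα p
    have hr := hermiteSeries_recurrence α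
    rw [add_assoc, one_add_one_eq_two] at hv
    refine ⟨jacobiSeries α (p + 1) * C (α + 1) * v, ?_⟩
    linear_combination hermiteSeries (α + 1) * h - jacobiSeries α (p + 1) * hr +
      jacobiSeries α (p + 1) * C (α + 1) * X ^ 2 * hv

lemma rescale_neg_one_jacobiSeries (p : ℕ) {α : ℝ} (hα : 0 < α) :
    rescale (-1) (jacobiSeries α p) = jacobiSeries α p := by
  induction p generalizing α with
  | zero => simp [jacobiSeries_zero]
  | succ p ih =>
    have h := jacobiSeries_succ hα p
    have h' := congrArg (rescale (-1 : ℝ)) h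
    have hC : rescale (-1 : ℝ) (C (α + 1)) = C (α + 1) := by
      ext n
      rw [coeff_rescale, coeff_C]
      split_ifs with hn <;> simp [hn]
    have hX : rescale (-1 : ℝ) X = -X := by simp [rescale_X]
    simp only [map_mul, map_sub, map_one, map_pow, ih (add_pos hα one_pos), hC, hX, neg_sq] at h'
    linear_combination jacobiSeries α (p + 1) * h' - rescale (-1 : ℝ) (jacobiSeries α (p + 1)) * h

lemma coeff_jacobiSeries_of_odd (p : ℕ) {α : ℝ} (hα : 0 < α) {k : ℕ} (hk : Odd k) :
    coeff k (jacobiSeries α p) = 0 := by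
  have h := congrArg (coeff k) (rescale_neg_one_jacobiSeries p hα)
  rw [coeff_rescale, hk.neg_one_pow] at h
  linarith

end JacobiMatrix

section MeanSeries

open PowerSeries

/-- The law of the entries of the random tridiagonal matrix. -/
noncomputable def entryLaw (α : ℝ) (p : ℕ) : Measure ((Fin (p + 1) → ℝ) × (Fin p → ℝ)) :=
  (Measure.pi fun _ : Fin (p + 1) => gaussianReal 0 1).prod
    (Measure.pi fun _ : Fin p => tildeChiMeasure α)

/-- The coefficientwise expectation of the `k`-th power of the corner series. -/
noncomputable def meanSeries (α : ℝ) (p k : ℕ) : PowerSeries ℝ :=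
  mk fun m => ∫ ω, coeff m (cornerSeries ω.1 ω.2 ^ k) ∂(entryLaw α p)

lemma isProbabilityMeasure_entryLaw {α : ℝ} (hα : 0 < α) (p : ℕ) :
    IsProbabilityMeasure (entryLaw α p) := by
  have := isProbabilityMeasure_tildeChiMeasure hα
  unfold entryLaw
  infer_instance

lemma meanSeries_pow_zero {α : ℝ} (hα : 0 < α) (p : ℕ) : meanSeries α p 0 = 1 := by
  have := isProbabilityMeasure_entryLaw hα p
  ext m
  simp [meanSeries]

lemma integrable_coeff_cornerSeries_zero {α : ℝ} (hα : 0 < α) (k m : ℕ) :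
    Integrable (fun ω : (Fin 1 → ℝ) × (Fin 0 → ℝ) => coeff m (cornerSeries ω.1 ω.2 ^ k))
      (entryLaw α 0) ∧ coeff m (meanSeries α 0 k) = coeff m (hermiteSeries k) := by
  have := isProbabilityMeasure_tildeChiMeasure hα
  have hexp : ∀ ω : (Fin 1 → ℝ) × (Fin 0 → ℝ), coeff m (cornerSeries ω.1 ω.2 ^ k) =
      risingFactorial k m / m.factorial * ω.1 0 ^ m := by
    intro ω
    have h := cornerSeries_zero ω.1 ω.2
    rw [coeff_pow_eq_sum _ 0 (ω.1 0) 0 (by simpa using h) k (m + 1) m m.lt_succ_self,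
      Finset.sum_eq_single m]
    · rw [Finset.sum_eq_single 0]
      · simp
      · intro l _ hl
        simp [hl]
      · simp
    · intro i _ hi
      refine Finset.sum_eq_zero fun l _ => ?_
      rcases eq_or_ne l 0 with rfl | hl
      · simp [coeff_X_pow, hi.symm]
      · simp [hl]
    · simp
  have hmp : MeasurePreserving (fun ω : (Fin 1 → ℝ) × (Fin 0 → ℝ) => ω.1 0) (entryLaw α 0)
      (gaussianReal 0 1) :=
    (measurePreserving_eval (fun _ : Fin 1 => gaussianReal 0 1) 0).comp measurePreserving_fst
  have hint := integrable_pow_gaussianReal m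
  constructor
  · simp only [hexp]
    exact (hmp.integrable_comp_of_integrable hint).const_mul _
  · simp only [meanSeries, coeff_mk, hexp, hermiteSeries]
    have hmap : ∫ ω, ω.1 0 ^ m ∂(entryLaw α 0) = ∫ x, x ^ m ∂(gaussianReal 0 1) := by
      rw [← hmp.map_eq, integral_map hmp.measurable.aemeasurable (by fun_prop)]
    rw [integral_const_mul, hmap, integral_pow_gaussianReal]
    have h1 : (m.factorial : ℝ) ≠ 0 := by positivity
    field_simp

lemma integrable_and_coeff_meanSeries_succ {α : ℝ} (hα : 0 < α) (p : ℕ)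
    (hint : ∀ l m, Integrable (fun ω : (Fin (p + 1) → ℝ) × (Fin p → ℝ) =>
      coeff m (cornerSeries ω.1 ω.2 ^ l)) (entryLaw α p)) (k n m : ℕ) (hm : m < n) :
    Integrable (fun ω : (Fin (p + 2) → ℝ) × (Fin (p + 1) → ℝ) =>
        coeff m (cornerSeries ω.1 ω.2 ^ k)) (entryLaw α (p + 1)) ∧
      coeff m (meanSeries α (p + 1) k) = coeff m (∑ i ∈ Finset.range n, ∑ l ∈ Finset.range n,
        C (risingFactorial k (i + l) * gaussCoeff i * risingFactorial α l / l.factorial) *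
          (X ^ (i + 2 * l) * meanSeries α p l)) := by
  have := isProbabilityMeasure_tildeChiMeasure hα
  have hshift : ∀ d l, Integrable (fun ω : (Fin (p + 1) → ℝ) × (Fin p → ℝ) =>
      coeff m (X ^ d * cornerSeries ω.1 ω.2 ^ l)) (entryLaw α p) ∧
      ∫ ω, coeff m (X ^ d * cornerSeries ω.1 ω.2 ^ l) ∂(entryLaw α p) =
        coeff m (X ^ d * meanSeries α p l) := by
    intro d l
    simp only [coeff_X_pow_mul']
    split_ifs
    · exact ⟨hint _ _, by rw [meanSeries, coeff_mk]⟩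
    · simp
  have hterm := fun i l : ℕ => integrable_and_integral_head_tail (gaussianReal 0 1)
    (tildeChiMeasure α) (integrable_pow_gaussianReal i)
    (integrable_and_integral_even_pow_tildeChiMeasure hα l).1 (hshift (i + 2 * l) l).1
  have hexp : ∀ ω : (Fin (p + 2) → ℝ) × (Fin (p + 1) → ℝ),
      coeff m (cornerSeries ω.1 ω.2 ^ k) = ∑ i ∈ Finset.range n, ∑ l ∈ Finset.range n,
        risingFactorial k (i + l) / (i.factorial * l.factorial) *
          (ω.1 0 ^ i * ω.2 0 ^ (2 * l) *
            coeff m (X ^ (i + 2 * l) * cornerSeries (Fin.tail ω.1) (Fin.tail ω.2) ^ l)) := by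
    intro ω
    rw [coeff_pow_eq_sum _ _ _ _ (cornerSeries_succ ω.1 ω.2) k n m hm]
    simp only [pow_mul]
  have hI : ∀ i ∈ Finset.range n, ∀ l ∈ Finset.range n,
      Integrable (fun ω : (Fin (p + 2) → ℝ) × (Fin (p + 1) → ℝ) =>
        risingFactorial k (i + l) / (i.factorial * l.factorial) *
          (ω.1 0 ^ i * ω.2 0 ^ (2 * l) *
            coeff m (X ^ (i + 2 * l) * cornerSeries (Fin.tail ω.1) (Fin.tail ω.2) ^ l)))
        (entryLaw α (p + 1)) := fun i _ l _ => (hterm i l).1.const_mul _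
  constructor
  · simp only [hexp]
    exact integrable_finsetSum _ fun i hi => integrable_finsetSum _ fun l hl => hI i hi l hl
  · simp only [map_sum, coeff_C_mul]
    rw [meanSeries, coeff_mk]
    simp only [hexp]
    rw [integral_finsetSum _ fun i hi => integrable_finsetSum _ fun l hl => hI i hi l hl]
    refine Finset.sum_congr rfl fun i hi => ?_
    rw [integral_finsetSum _ fun l hl => hI i hi l hl]
    refine Finset.sum_congr rfl fun l hl => ?_
    rw [integral_const_mul]
    have h := (hterm i l).2
    rw [integral_pow_gaussianReal, (integrable_and_integral_even_pow_tildeChiMeasure hα l).2,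
      Gamma_add_natCast_div hα] at h
    have h2 := (hshift (i + 2 * l) l).2
    simp only [entryLaw] at h2 ⊢
    rw [h2] at h
    rw [h]
    have h1 : (i.factorial : ℝ) ≠ 0 := by positivity
    field_simp

/-- Modulo `x ^ (2 p + 2)`, the expectation of the `k`-th power of the corner series is
the quotient of the Hermite series with parameters `α + k` and `α`. -/
lemma integrable_and_X_pow_dvd_meanSeries {α : ℝ} (hα : 0 < α) (p : ℕ) :
    (∀ k m, Integrable (fun ω : (Fin (p + 1) → ℝ) × (Fin p → ℝ) =>
      coeff m (cornerSeries ω.1 ω.2 ^ k)) (entryLaw α p)) ∧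
    ∀ k : ℕ, X ^ (2 * p + 2) ∣ meanSeries α p k * hermiteSeries α - hermiteSeries (α + k) := by
  induction p with
  | zero =>
    refine ⟨fun k m => (integrable_coeff_cornerSeries_zero hα k m).1, fun k => ?_⟩
    have hmean : meanSeries α 0 k = hermiteSeries k :=
      PowerSeries.ext fun m => (integrable_coeff_cornerSeries_zero hα k m).2
    rw [hmean, X_pow_dvd_iff]
    intro m hm
    interval_cases m
    · simp [hermiteSeries, risingFactorial_zero, gaussCoeff_zero]
    · simp [hermiteSeries, coeff_mul, Finset.Nat.antidiagonal_succ, gaussCoeff_one]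
  | succ p ih =>
    obtain ⟨hint, hdvd⟩ := ih
    refine ⟨fun k m => (integrable_and_coeff_meanSeries_succ hα p hint k _ m
      m.lt_succ_self).1, fun k => ?_⟩
    set n := 2 * (p + 1) + 2 with hn
    set c : ℕ → ℕ → ℝ := fun i l =>
      risingFactorial k (i + l) * gaussCoeff i * risingFactorial α l / l.factorial with hc
    have h1 : X ^ n ∣ meanSeries α (p + 1) k - ∑ i ∈ Finset.range n, ∑ l ∈ Finset.range n,
        C (c i l) * (X ^ (i + 2 * l) * meanSeries α p l) := by
      rw [X_pow_dvd_iff]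
      intro m hm
      rw [map_sub, (integrable_and_coeff_meanSeries_succ hα p hint k n m hm).2, sub_self]
    have h2 : X ^ n ∣ (∑ i ∈ Finset.range n, ∑ l ∈ Finset.range n,
        C (c i l) * (X ^ (i + 2 * l) * meanSeries α p l)) * hermiteSeries α -
        ∑ i ∈ Finset.range n, ∑ l ∈ Finset.range n,
          C (c i l) * (X ^ (i + 2 * l) * hermiteSeries (α + l)) := by
      rw [Finset.sum_mul, ← Finset.sum_sub_distrib]
      refine Finset.dvd_sum fun i _ => ?_
      rw [Finset.sum_mul, ← Finset.sum_sub_distrib]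
      refine Finset.dvd_sum fun l _ => ?_
      have e : C (c i l) * (X ^ (i + 2 * l) * meanSeries α p l) * hermiteSeries α -
          C (c i l) * (X ^ (i + 2 * l) * hermiteSeries (α + l)) = C (c i l) *
            (X ^ (i + 2 * l) * (meanSeries α p l * hermiteSeries α - hermiteSeries (α + l))) := by
        ring
      rw [e]
      refine Dvd.dvd.mul_left ?_ _
      cases l with
      | zero => simp [meanSeries_pow_zero hα]
      | succ l =>
        refine dvd_trans ?_ (mul_dvd_mul_left _ (hdvd (l + 1)))
        rw [← pow_add]
        exact pow_dvd_pow _ (by omega)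
    have h3 : X ^ n ∣ (∑ i ∈ Finset.range n, ∑ l ∈ Finset.range n,
        C (c i l) * (X ^ (i + 2 * l) * hermiteSeries (α + l))) - hermiteSeries (α + k) := by
      rw [X_pow_dvd_iff]
      intro m hm
      rw [map_sub, coeff_sum_hermiteSeries α k n m hm, sub_self]
    have h := dvd_add (dvd_add (h1.mul_right (hermiteSeries α)) h2) h3
    convert! h using 1
    ring

end MeanSeries

/-- For the tridiagonal model with i.i.d. standard Gaussian diagonal and i.i.d.
`χ̃_{2α}` off-diagonal, the mean `(0,0)` entry of the `k`-th power equals `u_{k/2}(α)`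
for even `k` and vanishes for odd `k`. -/
theorem mean_corner_moment_iid_model (α : ℝ) (hα : 0 < α) (p k : ℕ) (hk : k ≤ 2 * p + 1) :
    (∫ ω : (Fin (p + 1) → ℝ) × (Fin p → ℝ),
        ((tridiagOf ω.1 ω.2) ^ k) 0 0
        ∂((Measure.pi fun _ : Fin (p + 1) => gaussianReal 0 1).prod
            (Measure.pi fun _ : Fin p => tildeChiMeasure α)))
      = if Even k then u α (k / 2) else 0 := by
  have hdet := X_pow_dvd_jacobiSeries_mul (k / 2) hα
  have hexp := (integrable_and_X_pow_dvd_meanSeries hα p).2 1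
  have hle : 2 * (k / 2) + 2 ≤ 2 * p + 2 := by omega
  have hdvd : (PowerSeries.X : PowerSeries ℝ) ^ (2 * (k / 2) + 2) ∣
      (meanSeries α p 1 - jacobiSeries α (k / 2)) * hermiteSeries α := by
    have h := dvd_sub ((pow_dvd_pow PowerSeries.X hle).trans hexp) hdet
    convert! h using 1
    push_cast
    ring
  have hunit : IsUnit (hermiteSeries α) := by
    rw [PowerSeries.isUnit_iff_constantCoeff]
    simp [hermiteSeries, risingFactorial_zero, gaussCoeff_zero]
  have hcoeff := PowerSeries.X_pow_dvd_iff.1 (hunit.dvd_mul_right.1 hdvd) k (by omega)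
  rw [map_sub, sub_eq_zero] at hcoeff
  simp only [meanSeries, PowerSeries.coeff_mk, pow_one, cornerSeries] at hcoeff
  refine hcoeff.trans ?_
  split_ifs with he
  · rw [coeff_jacobiSeries, u, Nat.two_mul_div_two_of_even he]
  · exact coeff_jacobiSeries_of_odd _ hα (Nat.not_even_iff_odd.1 he)
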